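/- For a real number x > 0, let t(x) be the unique integer with 2^{t(x)} ≤ x < 2^{t(x)+1}, let λ(x) = (x − 2^{t(x)})/2^{t(x)}, and for every integer t define p_t(x) = 1 − λ(x) if t = t(x), p_t(x) = λ(x) if t = t(x)+1, and p_t(x) = 0 otherwise. Then: (1) p_t(x) ∈ [0,1] for every integer t, ∑_{t∈ℤ} p_t(x) = 1, and ∑_{t∈ℤ} p_t(x)·2^t = x; and (2) for all reals x, y > 0 and every integer t, |p_t(x) − p_t(y)| ≤ 4·|x − y| / 2^t. -/

import Mathlib

noncomputable section

lemma hat_le (u v : ℝ) :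
    max 0 (min (2 * u - 1) (2 - u)) ≤ max 0 (min (2 * v - 1) (2 - v)) + 4 * |u - v| := by
  have h1 := le_abs_self (u - v)
  have h2 := neg_abs_le (u - v)
  have h0 := abs_nonneg (u - v)
  have h3 := le_max_left 0 (min (2 * v - 1) (2 - v))
  have h4 := le_max_right 0 (min (2 * v - 1) (2 - v))
  have h5 := min_le_left (2 * u - 1) (2 - u)
  have h6 := min_le_right (2 * u - 1) (2 - u)
  apply max_le
  · linarith
  · rcases min_choice (2 * v - 1) (2 - v) with h | h <;> rw [h] at h4 <;> rw [h] <;>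
      rw [h] at h3 <;> linarith

/-- Dyadic interpolation weights.  For `x > 0`, `tfun x` is the unique integer with
`2 ^ tfun x ≤ x < 2 ^ (tfun x + 1)`, `lam x = (x - 2 ^ tfun x) / 2 ^ tfun x`, and for
every integer `t`, `p t x` equals `1 - lam x` if `t = tfun x`, `lam x` if
`t = tfun x + 1`, and `0` otherwise.  Then the weights `p t x` lie in `[0,1]`, sum to
`1`, satisfy `∑ t, p t x · 2 ^ t = x`, and `|p t x - p t y| ≤ 4 |x - y| / 2 ^ t`. -/
theorem dyadic_weights (tfun : ℝ → ℤ)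
    (htfun : ∀ x : ℝ, 0 < x → (2 : ℝ) ^ tfun x ≤ x ∧ x < (2 : ℝ) ^ (tfun x + 1))
    (lam : ℝ → ℝ)
    (hlam : ∀ x : ℝ, lam x = (x - (2 : ℝ) ^ tfun x) / (2 : ℝ) ^ tfun x)
    (p : ℤ → ℝ → ℝ)
    (hp : ∀ (t : ℤ) (x : ℝ),
      p t x = if t = tfun x then 1 - lam x else if t = tfun x + 1 then lam x else 0) :
    (∀ x : ℝ, 0 < x →
      (∀ t : ℤ, p t x ∈ Set.Icc (0 : ℝ) 1) ∧
      (∑' t : ℤ, p t x) = 1 ∧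
      (∑' t : ℤ, p t x * (2 : ℝ) ^ t) = x) ∧
    (∀ x y : ℝ, 0 < x → 0 < y → ∀ t : ℤ,
      |p t x - p t y| ≤ 4 * |x - y| / (2 : ℝ) ^ t) := by
  have hpow : ∀ t : ℤ, (0 : ℝ) < (2 : ℝ) ^ t := fun t => by positivity
  have hsucc : ∀ t : ℤ, (2 : ℝ) ^ (t + 1) = 2 * (2 : ℝ) ^ t := fun t => by
    rw [zpow_add_one₀ (by norm_num)]; ring
  have hl : ∀ x : ℝ, 0 < x → 0 ≤ lam x ∧ lam x < 1 ∧ lam x * (2 : ℝ) ^ tfun x = x - 2 ^ tfun x := by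
    intro x hx
    obtain ⟨h1, h2⟩ := htfun x hx
    rw [hsucc] at h2
    have := hpow (tfun x)
    rw [hlam]
    refine ⟨div_nonneg (by linarith) this.le, ?_, ?_⟩
    · rw [div_lt_one this]; linarith
    · field_simp
  have key : ∀ x : ℝ, 0 < x → ∀ t : ℤ,
      p t x = max 0 (min (2 * (x / 2 ^ t) - 1) (2 - x / 2 ^ t)) := by
    intro x hx t
    obtain ⟨h1, h2⟩ := htfun x hx
    obtain ⟨l0, l1, l2⟩ := hl x hx
    have ht := hpow t
    rw [hp]
    split_ifs with c1 c2
    · subst c1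
      have e : x / 2 ^ tfun x = 1 + lam x := by
        rw [div_eq_iff ht.ne']; linarith
      rw [e, min_eq_right (by linarith), max_eq_right (by linarith)]; ring
    · subst c2
      have e : x / 2 ^ (tfun x + 1) = (1 + lam x) / 2 := by
        rw [div_eq_iff ht.ne', hsucc]; linarith
      rw [e, min_eq_left (by linarith), max_eq_right (by linarith)]; ring
    · symm
      apply max_eq_left
      rcases lt_or_ge t (tfun x) with h | h
      · have h3 : (2 : ℝ) ^ (t + 1) ≤ 2 ^ tfun x := zpow_le_zpow_right₀ (by norm_num) (by omega)
        rw [hsucc] at h3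
        have : 2 ≤ x / 2 ^ t := by rw [le_div_iff₀ ht]; linarith
        exact (min_le_right _ _).trans (by linarith)
      · have h3 : (2 : ℝ) ^ (tfun x + 1 + 1) ≤ 2 ^ t := zpow_le_zpow_right₀ (by norm_num) (by omega)
        rw [hsucc] at h3
        have : x / 2 ^ t ≤ 1 / 2 := by rw [div_le_iff₀ ht]; linarith
        exact (min_le_left _ _).trans (by linarith)
  refine ⟨fun x hx => ?_, fun x y hx hy t => ?_⟩
  · obtain ⟨l0, l1, l2⟩ := hl x hx
    have ha : p (tfun x) x = 1 - lam x := by simp [hp]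
    have hb : p (tfun x + 1) x = lam x := by simp [hp]
    have hz : ∀ t, t ∉ ({tfun x, tfun x + 1} : Finset ℤ) → p t x = 0 := by
      intro t ht
      simp only [Finset.mem_insert, Finset.mem_singleton, not_or] at ht
      simp [hp, ht.1, ht.2]
    have hne : tfun x ≠ tfun x + 1 := by omega
    refine ⟨fun t => ?_, ?_, ?_⟩
    · rw [hp]
      split_ifs <;> constructor <;> linarith
    · rw [tsum_eq_sum hz, Finset.sum_pair hne, ha, hb]; ring
    · rw [tsum_eq_sum (s := {tfun x, tfun x + 1}) (fun t ht => by rw [hz t ht, zero_mul]),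
        Finset.sum_pair hne, ha, hb, hsucc]
      linarith
  · have ht := hpow t
    have e : 4 * |x - y| / (2 : ℝ) ^ t = 4 * |x / 2 ^ t - y / 2 ^ t| := by
      rw [← sub_div, abs_div, abs_of_pos ht]; ring
    rw [e, key x hx, key y hy, abs_le]
    have a1 := hat_le (x / 2 ^ t) (y / 2 ^ t)
    have a2 := hat_le (y / 2 ^ t) (x / 2 ^ t)
    rw [abs_sub_comm (y / 2 ^ t)] at a2
    constructor <;> linarith
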